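/- Let $f,g\in C^\infty(\mathbb{T}^3)$ and $\lambda\in\mathbb{N}$, $\lambda\geq1$. Then $\|f(\cdot)\,g(\lambda\cdot)\|_{L^1(\mathbb{T}^3)}\leq \|f\|_{L^1(\mathbb{T}^3)}\|g\|_{L^1(\mathbb{T}^3)}+C\lambda^{-1}\|f\|_{C^1(\mathbb{T}^3)}\|g\|_{L^1(\mathbb{T}^3)}$ for an absolute constant $C$, where $L^1$ norms are normalized (averages over one period). -/

import Mathlib

open MeasureTheory

/-- One period of the torus `𝕋³ = (ℝ/2πℤ)³`, realized as a box in `ℝ³`. -/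
noncomputable def torusBox : Set (Fin 3 → ℝ) := Set.Icc 0 (fun _ => 2 * Real.pi)

def Per {α : Type*} (h : (Fin 3 → ℝ) → α) : Prop :=
  ∀ (x : Fin 3 → ℝ) (v : Fin 3 → ℤ), h (x + fun i => 2 * Real.pi * (v i)) = h x

lemma two_pi_unit : ∀ _ : Fin 3, IsUnit (2 * Real.pi) := fun _ =>
  isUnit_iff_ne_zero.mpr (by positivity)

noncomputable def tBasis : Module.Basis (Fin 3) ℝ (Fin 3 → ℝ) :=
  (Pi.basisFun ℝ (Fin 3)).isUnitSMul two_pi_unit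

lemma tBasis_repr (x : Fin 3 → ℝ) (i : Fin 3) : tBasis.repr x i = (2 * Real.pi)⁻¹ * x i := by
  unfold tBasis
  rw [Module.Basis.repr_isUnitSMul]
  simp [Units.smul_def]

lemma fd_eq : ZSpan.fundamentalDomain tBasis
    = Set.univ.pi fun i => Set.Ico ((0 : Fin 3 → ℝ) i) ((fun _ => 2 * Real.pi : Fin 3 → ℝ) i) := by
  ext x
  have hp : 0 < 2 * Real.pi := by positivity
  simp only [ZSpan.mem_fundamentalDomain, tBasis_repr, Set.mem_pi, Set.mem_univ, true_imp_iff,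
    Set.mem_Ico, Pi.zero_apply]
  refine forall_congr' fun i => and_congr ?_ ?_
  · constructor
    · intro h
      exact nonneg_of_mul_nonneg_right h (inv_pos.mpr hp)
    · intro h; positivity
  · rw [inv_mul_lt_iff₀ hp, mul_one]

lemma fd_ae : ZSpan.fundamentalDomain tBasis =ᵐ[volume] torusBox := by
  rw [fd_eq]
  exact Measure.univ_pi_Ico_ae_eq_Icc

open scoped Pointwise in
lemma integral_shift (h : (Fin 3 → ℝ) → ℝ) (hp : Per h) (y : Fin 3 → ℝ) :
    ∫ x in torusBox, h (x + y) = ∫ x in torusBox, h x := by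
  rw [← setIntegral_congr_set fd_ae, ← setIntegral_congr_set fd_ae]
  have hD := ZSpan.isAddFundamentalDomain tBasis (volume : Measure (Fin 3 → ℝ))
  have hinv : ∀ (g : ↥(Submodule.span ℤ (Set.range tBasis))) (x : Fin 3 → ℝ),
      h (g +ᵥ x) = h x := by
    rintro ⟨g, hg⟩ x
    rw [Module.Basis.mem_span_iff_repr_mem] at hg
    choose v hv using hg
    have : g = fun i => 2 * Real.pi * (v i) := by
      funext i
      have := hv i
      rw [tBasis_repr] at this
      have h2 : (2 * Real.pi) ≠ 0 := by positivity
      simp only [algebraMap_int_eq, eq_intCast] at this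
      rw [this]; field_simp
    change h (g + x) = h x
    rw [add_comm, this]
    exact hp x v
  have hDy := hD.vadd_of_comm y
  have : VAddInvariantMeasure (↥(Submodule.span ℤ (Set.range tBasis))) (Fin 3 → ℝ) volume :=
    ⟨fun c s _ => measure_preimage_add volume (c : Fin 3 → ℝ) s⟩
  rw [hD.setIntegral_eq hDy hinv]
  rw [← (measurePreserving_add_right volume y).setIntegral_preimage_emb
    (MeasurableEquiv.addRight y).measurableEmbedding h (y +ᵥ ZSpan.fundamentalDomain tBasis)]
  congr 2
  ext x
  simp [Set.mem_vadd_set_iff_neg_vadd_mem]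

lemma per_box (x : Fin 3 → ℝ) : ∃ z ∈ torusBox, ∃ v : Fin 3 → ℤ,
    x = z + fun i => 2 * Real.pi * (v i) := by
  have hp : 0 < 2 * Real.pi := by positivity
  refine ⟨fun i => x i - 2 * Real.pi * ⌊x i / (2 * Real.pi)⌋, ⟨fun i => ?_, fun i => ?_⟩,
    fun i => ⌊x i / (2 * Real.pi)⌋, ?_⟩
  · have := Int.floor_le (x i / (2 * Real.pi))
    rw [le_div_iff₀ hp] at this
    simp only [Pi.zero_apply]; linarith
  · have := (Int.lt_floor_add_one (x i / (2 * Real.pi))).le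
    rw [div_le_iff₀ hp] at this
    simp only; linarith
  · funext i; simp

lemma compact_box : IsCompact torusBox := isCompact_Icc

lemma per_bdd (h : (Fin 3 → ℝ) → ℝ) (hc : Continuous h) (hp : Per h) :
    BddAbove (Set.range h) := by
  obtain ⟨M, hM⟩ := compact_box.bddAbove_image hc.continuousOn
  refine ⟨M, ?_⟩
  rintro _ ⟨x, rfl⟩
  obtain ⟨z, hz, v, rfl⟩ := per_box x
  rw [hp z v]
  exact hM ⟨z, hz, rfl⟩

lemma vol_box : (volume : Measure (Fin 3 → ℝ)).real torusBox = (2 * Real.pi) ^ 3 := by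
  unfold torusBox
  rw [measureReal_def, Real.volume_Icc_pi_toReal]
  · simp
  · intro i; simp only [Pi.zero_apply]; positivity

lemma int_box {h : (Fin 3 → ℝ) → ℝ} (hc : Continuous h) : IntegrableOn h torusBox :=
  hc.continuousOn.integrableOn_compact compact_box

lemma per_fderiv (f : (Fin 3 → ℝ) → ℝ) (hp : Per f) : Per (fderiv ℝ f) := by
  intro x v
  rw [← fderiv_comp_add_right]
  congr 1
  funext y
  exact hp y v

lemma key (F G : (Fin 3 → ℝ) → ℝ) (hF : Continuous F) (hG : Continuous G)
    (pF : Per F) (pG : Per G) (hG0 : ∀ x, 0 ≤ G x) (lam : ℕ) (hl : 1 ≤ lam) (L : ℝ)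
    (hL : ∀ x y, F (x + y) ≤ F x + L * ‖y‖) (hL0 : 0 ≤ L) :
    (2 * Real.pi) ^ 3 * (∫ x in torusBox, F x * G ((lam : ℝ) • x))
      ≤ ((∫ x in torusBox, F x) + (2 * Real.pi) ^ 3 * (L * (2 * Real.pi * (lam : ℝ)⁻¹)))
        * ∫ x in torusBox, G x := by
  have hl0 : (lam : ℝ) ≠ 0 := by positivity
  set δ := L * (2 * Real.pi * (lam : ℝ)⁻¹) with hδ
  set H : (Fin 3 → ℝ) → (Fin 3 → ℝ) → ℝ :=
    fun z x => F (x + (lam : ℝ)⁻¹ • z) * G ((lam : ℝ) • x + z) with hH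
  have hHc : Continuous (Function.uncurry H) := by
    simp only [hH, Function.uncurry_def]; fun_prop
  have hHi : Integrable (Function.uncurry H)
      ((volume.restrict torusBox).prod (volume.restrict torusBox)) := by
    rw [Measure.prod_restrict]
    exact hHc.continuousOn.integrableOn_compact (compact_box.prod compact_box)
  have h1 : ∀ z, ∫ x in torusBox, H z x = ∫ x in torusBox, F x * G ((lam : ℝ) • x) := by
    intro z
    rw [← integral_shift (fun x => F x * G ((lam : ℝ) • x)) ?_ ((lam : ℝ)⁻¹ • z)]
    · simp only [hH, smul_add, smul_inv_smul₀ hl0]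
    · intro x v
      have := pG ((lam : ℝ) • x) (fun i => lam * v i)
      simp only [pF x v]
      rw [← this]
      congr 2
      funext i
      simp only [Pi.smul_apply, Pi.add_apply, smul_eq_mul]
      push_cast; ring
  have h2 : (2 * Real.pi) ^ 3 * (∫ x in torusBox, F x * G ((lam : ℝ) • x))
      = ∫ z in torusBox, ∫ x in torusBox, H z x := by
    simp only [h1, setIntegral_const, vol_box, smul_eq_mul]
  have h3 : ∀ x, ∫ z in torusBox, H z x ≤ (F x + δ) * ∫ z in torusBox, G z := by
    intro x
    rw [← integral_shift G pG ((lam : ℝ) • x), ← integral_const_mul]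
    refine setIntegral_mono_on ?_ ?_ compact_box.measurableSet ?_
    · exact int_box (by simp only [hH]; fun_prop)
    · exact int_box (by fun_prop)
    · intro z hz
      simp only [hH]
      rw [add_comm z]
      refine mul_le_mul_of_nonneg_right ((hL _ _).trans ?_) (hG0 _)
      have : ‖z‖ ≤ 2 * Real.pi := by
        rw [pi_norm_le_iff_of_nonneg (by positivity)]
        intro i
        rw [Real.norm_of_nonneg (hz.1 i)]
        exact hz.2 i
      rw [norm_smul, norm_inv, Real.norm_natCast, hδ, mul_comm (lam : ℝ)⁻¹]
      gcongr
  rw [h2, integral_integral_swap hHi]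
  calc _ ≤ ∫ x in torusBox, (F x + δ) * ∫ z in torusBox, G z := by
        refine integral_mono hHi.integral_prod_right ?_ h3
        exact int_box (by fun_prop)
    _ = _ := by
        rw [integral_mul_const, integral_add (int_box hF) (int_box continuous_const),
          setIntegral_const, vol_box, smul_eq_mul]

/-- Improved Hölder inequality (Modena–Székelyhidi): for smooth `2π`-periodic
`f, g` on `ℝ³` and an integer `λ ≥ 1`,
`‖f(·) g(λ·)‖_{L¹(𝕋³)} ≤ ‖f‖_{L¹} ‖g‖_{L¹} + C λ⁻¹ ‖f‖_{C¹} ‖g‖_{L¹}`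
with normalized `L¹` norms and an absolute constant `C`. -/
theorem stmt6 :
    ∃ C : ℝ, 0 < C ∧
    ∀ (f g : (Fin 3 → ℝ) → ℝ),
      ContDiff ℝ (⊤ : ℕ∞) f → ContDiff ℝ (⊤ : ℕ∞) g →
      (∀ (x : Fin 3 → ℝ) (v : Fin 3 → ℤ), f (x + fun i => 2 * Real.pi * (v i)) = f x) →
      (∀ (x : Fin 3 → ℝ) (v : Fin 3 → ℤ), g (x + fun i => 2 * Real.pi * (v i)) = g x) →
      ∀ lam : ℕ, 1 ≤ lam →
        ((2 * Real.pi) ^ 3)⁻¹ * (∫ x in torusBox, |f x * g ((lam : ℝ) • x)|)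
          ≤ (((2 * Real.pi) ^ 3)⁻¹ * ∫ x in torusBox, |f x|)
              * (((2 * Real.pi) ^ 3)⁻¹ * ∫ x in torusBox, |g x|)
            + C * (lam : ℝ)⁻¹
              * ((⨆ x : Fin 3 → ℝ, |f x|) + ⨆ x : Fin 3 → ℝ, ‖fderiv ℝ f x‖)
              * (((2 * Real.pi) ^ 3)⁻¹ * ∫ x in torusBox, |g x|) := by
  refine ⟨2 * Real.pi, by positivity, ?_⟩
  intro f g hf hg pf pg lam hl
  have hdc : Continuous (fderiv ℝ f) := hf.continuous_fderiv (by simp)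
  have pd := per_fderiv f pf
  have hb : BddAbove (Set.range fun x => ‖fderiv ℝ f x‖) :=
    per_bdd _ hdc.norm (fun x v => by simp only [pd x v])
  set L := ⨆ x : Fin 3 → ℝ, ‖fderiv ℝ f x‖ with hLdef
  have hL0 : 0 ≤ L := Real.iSup_nonneg fun _ => norm_nonneg _
  have hS0 : 0 ≤ ⨆ x : Fin 3 → ℝ, |f x| := Real.iSup_nonneg fun _ => abs_nonneg _
  have hL : ∀ x y, |f (x + y)| ≤ |f x| + L * ‖y‖ := by
    intro x y
    have := Convex.norm_image_sub_le_of_norm_fderiv_le (𝕜 := ℝ) (f := f) (s := Set.univ) (C := L)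
      (x := x) (y := x + y) (fun x _ => (hf.differentiable (by simp)) x)
      (fun x _ => le_ciSup hb x) convex_univ trivial trivial
    rw [add_sub_cancel_left, Real.norm_eq_abs] at this
    have h2 := abs_sub_abs_le_abs_sub (f (x + y)) (f x)
    linarith
  have hk := key (fun x => |f x|) (fun x => |g x|) hf.continuous.abs hg.continuous.abs
    (fun x v => by simp only [pf x v]) (fun x v => by simp only [pg x v])
    (fun x => abs_nonneg _) lam hl L hL hL0
  simp only [abs_mul]
  have hI : 0 ≤ ∫ x in torusBox, |g x| := integral_nonneg fun _ => abs_nonneg _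
  have hB : 0 < (2 * Real.pi) ^ 3 := by positivity
  have hli : 0 ≤ (lam : ℝ)⁻¹ := by positivity
  have hp : 0 ≤ 2 * Real.pi := by positivity
  generalize (∫ x in torusBox, |g x|) = IG at *
  generalize (∫ x in torusBox, |f x|) = IF at *
  generalize (∫ x in torusBox, |f x| * |g ((lam : ℝ) • x)|) = J at *
  generalize (⨆ x : Fin 3 → ℝ, |f x|) = S at *
  generalize (2 * Real.pi) ^ 3 = B at *
  calc B⁻¹ * J = B⁻¹ * B⁻¹ * (B * J) := by field_simp
    _ ≤ B⁻¹ * B⁻¹ * ((IF + B * (L * (2 * Real.pi * (lam : ℝ)⁻¹))) * IG) := by gcongr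
    _ = (B⁻¹ * IF) * (B⁻¹ * IG) + 2 * Real.pi * (lam : ℝ)⁻¹ * (0 + L) * (B⁻¹ * IG) := by
      field_simp; ring
    _ ≤ _ := by gcongr
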